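/- Let G be a connected graph of order n > 3 with m edges. If the diameter of G is at least 3, then tmc(G) = m − n + 2 + l(G). -/

import Mathlib

open SimpleGraph

/-- A walk in a total-colored graph is *total monochromatic* if all of its edges and
internal vertices have the same color. -/
def IsTotalMonoWalk {V : Type*} {G : SimpleGraph V} (ce : Sym2 V → ℕ) (cv : V → ℕ)
    {u v : V} (w : G.Walk u v) : Prop :=
  ∃ c, (∀ e ∈ w.edges, ce e = c) ∧ ∀ x ∈ w.support.tail.dropLast, cv x = c

/-- A total coloring (edge coloring `ce`, vertex coloring `cv`) of `G` is a
*TMC-coloring* if any two vertices are connected by a total monochromatic path. -/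
def IsTMCColoring {V : Type*} (G : SimpleGraph V) (ce : Sym2 V → ℕ) (cv : V → ℕ) : Prop :=
  ∀ u v : V, u ≠ v → ∃ w : G.Walk u v, w.IsPath ∧ IsTotalMonoWalk ce cv w

/-- The number of colors used by a total coloring of `G`:
colors appearing on edges of `G` together with colors appearing on vertices. -/
noncomputable def colorsUsed {V : Type*} (G : SimpleGraph V) (ce : Sym2 V → ℕ) (cv : V → ℕ) : ℕ :=
  (ce '' G.edgeSet ∪ Set.range cv).ncard

/-- The total monochromatic connection number `tmc G`: the maximum number of colors
used in a TMC-coloring of `G`. -/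
noncomputable def tmc {V : Type*} [Fintype V] (G : SimpleGraph V) : ℕ :=
  sSup {k | ∃ ce cv, IsTMCColoring G ce cv ∧ colorsUsed G ce cv = k}

/-- The number of leaves (vertices of degree one) of a graph. -/
noncomputable def numLeaves {V : Type*} (T : SimpleGraph V) : ℕ :=
  {v : V | (T.neighborSet v).ncard = 1}.ncard

/-- `maxLeaves G` is the maximum number of leaves over all spanning trees of `G`. -/
noncomputable def maxLeaves {V : Type*} [Fintype V] (G : SimpleGraph V) : ℕ :=
  sSup {k | ∃ T : SimpleGraph V, T ≤ G ∧ T.IsTree ∧ numLeaves T = k}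


/-- Forest bound: vertices outside the root set `P` that reach `P` inject into edges. -/
theorem forest_bound {V : Type*} [Fintype V] (H : SimpleGraph V) (P S : Set V)
    (hd : ∀ x ∈ S, x ∉ P) (hr : ∀ x ∈ S, ∃ r ∈ P, H.Reachable x r) :
    S.ncard ≤ H.edgeSet.ncard := by
  classical
  let d : V → ℕ := fun x => sInf {k | ∃ r ∈ P, ∃ w : H.Walk x r, w.length = k}
  have key : ∀ x : V, ∃ y : V, x ∈ S → H.Adj x y ∧ d y < d x := by
    intro x
    by_cases hx : x ∈ S
    · have hne : {k | ∃ r ∈ P, ∃ w : H.Walk x r, w.length = k}.Nonempty := by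
        obtain ⟨r, hrP, ⟨w⟩⟩ := hr x hx
        exact ⟨_, r, hrP, w, rfl⟩
      obtain ⟨r, hrP, w, hw⟩ := Nat.sInf_mem hne
      cases w with
      | nil => exact absurd hrP (hd x hx)
      | @cons _ y _ h q =>
        refine ⟨y, fun _ => ⟨h, ?_⟩⟩
        have h1 : d y ≤ q.length := Nat.sInf_le ⟨r, hrP, q, rfl⟩
        have h2 : q.length + 1 = d x := by simpa using hw
        omega
    · exact ⟨x, fun h => absurd h hx⟩
  choose p hp using key
  refine Set.ncard_le_ncard_of_injOn (fun x => s(x, p x)) ?_ ?_ (Set.toFinite _)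
  · intro x hx
    exact (hp x hx).1
  · intro x hx y hy hxy
    simp only [Sym2.eq_iff] at hxy
    rcases hxy with h | ⟨h1, h2⟩
    · exact h.1
    · have a := (hp x hx).2
      have b := (hp y hy).2
      rw [h2] at a
      rw [← h1] at b
      omega

/-- The subgraph of edges of colour `c`. -/
def colorSub {V : Type*} (G : SimpleGraph V) (ce : Sym2 V → ℕ) (c : ℕ) : SimpleGraph V where
  Adj a b := G.Adj a b ∧ ce s(a, b) = c
  symm := ⟨fun a b h => ⟨h.1.symm, by rw [Sym2.eq_swap]; exact h.2⟩⟩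
  loopless := ⟨fun a h => G.loopless.irrefl a h.1⟩

theorem colorSub_edgeSet {V : Type*} (G : SimpleGraph V) (ce : Sym2 V → ℕ) (c : ℕ) :
    (colorSub G ce c).edgeSet = {e | e ∈ G.edgeSet ∧ ce e = c} := by
  ext e
  induction e with
  | _ a b => rfl

theorem colorSub_reach {V : Type*} (G : SimpleGraph V) (ce : Sym2 V → ℕ) (c : ℕ)
    {a b : V} (w : G.Walk a b) (hw : ∀ e ∈ w.edges, ce e = c) :
    (colorSub G ce c).Reachable a b := by
  induction w with
  | nil => exact Reachable.refl _
  | cons h q ih =>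
    simp only [Walk.edges_cons, List.mem_cons, forall_eq_or_imp] at hw
    have : (colorSub G ce c).Adj _ _ := ⟨h, hw.1⟩
    exact this.reachable.trans (ih hw.2)

/-- vertices served by colour `c` -/
def servedBy {V : Type*} (G H : SimpleGraph V) (u v : V) : Set V :=
  {x | x ≠ u ∧ x ≠ v ∧ ((¬ G.Adj u x ∧ H.Reachable u x) ∨ (¬ G.Adj v x ∧ H.Reachable v x))}

theorem servedBy_symm {V : Type*} (G H : SimpleGraph V) (u v : V) :
    servedBy G H u v = servedBy G H v u := by
  ext x
  simp only [servedBy, Set.mem_ofPred_eq]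
  tauto

theorem served_aux {V : Type*} [Fintype V] (G H : SimpleGraph V) (hHG : H ≤ G) (u v x : V)
    (huv : ¬ H.Reachable u v) (hxu : x ≠ u) (hx : H.Reachable u x) :
    (servedBy G H u v).ncard + 1 ≤ H.edgeSet.ncard := by
  classical
  obtain ⟨w⟩ := hx
  cases w with
  | nil => exact absurd rfl hxu
  | @cons _ y _ h q =>
    have hy : y ∉ servedBy G H u v := by
      rintro ⟨h1, h2, h3 | h3⟩
      · exact h3.1 (hHG h)
      · exact huv (h.reachable.trans h3.2.symm)
    rw [← Set.ncard_insert_of_notMem hy (Set.toFinite _)]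
    apply forest_bound H {u, v}
    · rintro z (rfl | hz)
      · rintro (h1 | h1)
        · exact h.ne h1.symm
        · rw [Set.mem_singleton_iff] at h1
          subst h1
          exact huv h.reachable
      · rintro (h1 | h1)
        · exact hz.1 h1
        · exact hz.2.1 h1
    · rintro z (rfl | hz)
      · exact ⟨u, by simp, h.symm.reachable⟩
      · rcases hz.2.2 with h1 | h1
        · exact ⟨u, by simp, h1.2.symm⟩
        · exact ⟨v, by simp, h1.2.symm⟩

theorem served_bound {V : Type*} [Fintype V] (G H : SimpleGraph V) (hHG : H ≤ G) (u v : V)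
    (hne : u ≠ v) (hE : H.edgeSet.Nonempty) :
    (servedBy G H u v).ncard + 1 ≤ H.edgeSet.ncard := by
  classical
  by_cases huv : H.Reachable u v
  · have hy : v ∉ servedBy G H u v := fun h => h.2.1 rfl
    rw [← Set.ncard_insert_of_notMem hy (Set.toFinite _)]
    apply forest_bound H {u}
    · rintro z (rfl | hz)
      · exact fun h => hne h.symm
      · exact fun h => hz.1 h
    · rintro z (rfl | hz)
      · exact ⟨u, by simp, huv.symm⟩
      · refine ⟨u, by simp, ?_⟩
        rcases hz.2.2 with h1 | h1
        · exact h1.2.symm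
        · exact (huv.trans h1.2).symm
  · rcases (servedBy G H u v).eq_empty_or_nonempty with h0 | ⟨x, hx⟩
    · rw [h0, Set.ncard_empty]
      exact (Set.ncard_pos (Set.toFinite _)).2 hE
    · rcases hx.2.2 with h1 | h1
      · exact served_aux G H hHG u v x huv hx.1 h1.2
      · rw [servedBy_symm]
        exact served_aux G H hHG v u x (fun h => huv h.symm) hx.2.1 h1.2

theorem edge_colors_bound {V : Type*} [Fintype V] (G : SimpleGraph V) (ce : Sym2 V → ℕ)
    (u v : V) (hne : u ≠ v) (hcn : ∀ x, ¬ (G.Adj u x ∧ G.Adj v x))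
    (hmc : ∀ a b : V, a ≠ b → ∃ w : G.Walk a b, ∃ c, ∀ e ∈ w.edges, ce e = c) :
    (ce '' G.edgeSet).ncard + Fintype.card V ≤ G.edgeSet.ncard + 2 := by
  classical
  let E : Finset (Sym2 V) := G.edgeSet.toFinset
  let C : Finset ℕ := E.image ce
  have hC : (ce '' G.edgeSet).ncard = C.card := by
    rw [← Set.ncard_coe_finset]
    congr 1
    ext; simp [C, E]
  have hE : G.edgeSet.ncard = E.card := Set.ncard_eq_toFinset_card' _
  have hcov : (Finset.univ \ {u, v} : Finset V) ⊆
      C.biUnion (fun c => (servedBy G (colorSub G ce c) u v).toFinset) := by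
    intro x hx
    simp only [Finset.mem_sdiff, Finset.mem_univ, Finset.mem_insert, Finset.mem_singleton,
      true_and, not_or] at hx
    have gen : ∀ a, x ≠ a → ∃ c ∈ C, (colorSub G ce c).Reachable a x := by
      intro a hxa
      obtain ⟨w, c, hw⟩ := hmc a x (Ne.symm hxa)
      refine ⟨c, ?_, colorSub_reach G ce c w hw⟩
      cases w with
      | nil => exact absurd rfl hxa
      | @cons _ y _ h q =>
        exact Finset.mem_image.2 ⟨s(a, y), by simpa [E] using h, hw _ (by simp)⟩
    rw [Finset.mem_biUnion]
    by_cases hux : G.Adj u x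
    · have hvx : ¬ G.Adj v x := fun h => hcn x ⟨hux, h⟩
      obtain ⟨c, hc, hr⟩ := gen v hx.2
      exact ⟨c, hc, by rw [Set.mem_toFinset]; exact ⟨hx.1, hx.2, Or.inr ⟨hvx, hr⟩⟩⟩
    · obtain ⟨c, hc, hr⟩ := gen u hx.1
      exact ⟨c, hc, by rw [Set.mem_toFinset]; exact ⟨hx.1, hx.2, Or.inl ⟨hux, hr⟩⟩⟩
  have h1 := (Finset.card_le_card hcov).trans Finset.card_biUnion_le
  have h2 : (Finset.univ \ {u, v} : Finset V).card = Fintype.card V - 2 := by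
    rw [Finset.card_sdiff_of_subset (Finset.subset_univ _), Finset.card_pair hne, Finset.card_univ]
  have h3 : ∑ c ∈ C, ((servedBy G (colorSub G ce c) u v).toFinset.card + 1) ≤
      ∑ c ∈ C, (E.filter (fun e => ce e = c)).card := by
    refine Finset.sum_le_sum fun c hc => ?_
    have hEc : (colorSub G ce c).edgeSet.ncard = (E.filter (fun e => ce e = c)).card := by
      rw [← Set.ncard_coe_finset, colorSub_edgeSet]
      congr 1
      ext; simp [E]
    rw [← Set.ncard_eq_toFinset_card', ← hEc]
    refine served_bound G (colorSub G ce c) (fun a b h => h.1) u v hne ?_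
    rw [colorSub_edgeSet]
    obtain ⟨e, he, hec⟩ := Finset.mem_image.1 hc
    exact ⟨e, by simpa [E] using he, hec⟩
  have h4 : E.card = ∑ c ∈ C, (E.filter (fun e => ce e = c)).card :=
    Finset.card_eq_sum_card_fiberwise fun e he => Finset.mem_coe.2 (Finset.mem_image_of_mem _ he)
  rw [Finset.sum_add_distrib] at h3
  simp only [Finset.sum_const, smul_eq_mul, mul_one] at h3
  omega

theorem walk_mem_interior {V : Type*} {G : SimpleGraph V} {a b y : V} (w : G.Walk a b)
    (hy : y ∈ w.support) (ha : y ≠ a) (hb : y ≠ b) : y ∈ w.support.tail.dropLast := by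
  cases w with
  | nil => simp at hy; exact absurd hy ha
  | cons h q =>
    simp only [Walk.support_cons, List.mem_cons, List.tail_cons] at hy ⊢
    rcases hy with hy | hy
    · exact absurd hy ha
    · rw [← List.dropLast_append_getLast q.support_ne_nil] at hy
      simp only [Walk.getLast_support, List.mem_append, List.mem_singleton] at hy
      exact hy.resolve_right hb

theorem numLeaves_bdd {V : Type*} [Fintype V] (G : SimpleGraph V) :
    BddAbove {k | ∃ T : SimpleGraph V, T ≤ G ∧ T.IsTree ∧ numLeaves T = k} := by
  refine ⟨Nat.card V, ?_⟩
  rintro k ⟨T, -, -, rfl⟩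
  exact Set.ncard_le_card _

theorem leaves_bound {V : Type*} [Fintype V] (G : SimpleGraph V) (Q : Set V)
    (hn : 3 < Fintype.card V) (w₀ : V) (hw₀ : w₀ ∈ Q)
    (hQ : ∀ a b : V, a ≠ b → ∃ w : G.Walk a b, ∀ x ∈ w.support, x ≠ a → x ≠ b → x ∈ Q) :
    Qᶜ.ncard ≤ maxLeaves G := by
  classical
  have hf : ∀ x : V, ∃ y, x ∉ Q → G.Adj x y ∧ y ∈ Q := by
    intro x
    by_cases hx : x ∈ Q
    · exact ⟨x, fun h => absurd hx h⟩
    · have hne : x ≠ w₀ := fun h => hx (h ▸ hw₀)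
      obtain ⟨w, hw⟩ := hQ x w₀ hne
      cases w with
      | nil => exact absurd rfl hne
      | @cons _ y _ h q =>
        refine ⟨y, fun _ => ⟨h, ?_⟩⟩
        by_cases hyw : y = w₀
        · exact hyw ▸ hw₀
        · exact hw y (by simp) h.ne' hyw
  choose f hf using hf
  let H : SimpleGraph V :=
    { Adj := fun a b => G.Adj a b ∧ ((a ∈ Q ∧ b ∈ Q) ∨ (a ∉ Q ∧ b = f a) ∨ (b ∉ Q ∧ a = f b))
      symm := ⟨fun a b h => ⟨h.1.symm, by tauto⟩⟩
      loopless := ⟨fun a h => G.loopless.irrefl a h.1⟩ }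
  have hHG : H ≤ G := fun a b h => h.1
  have walkQ : ∀ {a b : V} (w : G.Walk a b), (∀ x ∈ w.support, x ∈ Q) → H.Reachable a b := by
    intro a b w
    induction w with
    | nil => intro _; exact Reachable.refl _
    | cons h q ih =>
      intro hw
      simp only [Walk.support_cons, List.mem_cons, forall_eq_or_imp] at hw
      have : H.Adj _ _ := ⟨h, Or.inl ⟨hw.1, hw.2 _ q.start_mem_support⟩⟩
      exact this.reachable.trans (ih hw.2)
  have reachQ : ∀ x ∈ Q, H.Reachable x w₀ := by
    intro x hx
    by_cases hne : x = w₀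
    · rw [hne]
    · obtain ⟨w, hw⟩ := hQ x w₀ hne
      refine walkQ w fun z hz => ?_
      by_cases h1 : z = x
      · exact h1 ▸ hx
      by_cases h2 : z = w₀
      · exact h2 ▸ hw₀
      exact hw z hz h1 h2
  have reach : ∀ x, H.Reachable x w₀ := by
    intro x
    by_cases hx : x ∈ Q
    · exact reachQ x hx
    · have : H.Adj x (f x) := ⟨(hf x hx).1, Or.inr (Or.inl ⟨hx, rfl⟩)⟩
      exact this.reachable.trans (reachQ _ (hf x hx).2)
  have : Nonempty V := ⟨w₀⟩
  have hHc : H.Connected := ⟨fun a b => (reach a).trans (reach b).symm⟩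
  obtain ⟨T, hTH, hT⟩ := hHc.exists_isTree_le
  have : Nontrivial V := Fintype.one_lt_card_iff_nontrivial.1 (by omega)
  have hle : numLeaves T ≤ maxLeaves G :=
    le_csSup (numLeaves_bdd G) ⟨T, hTH.trans hHG, hT, rfl⟩
  refine le_trans (Set.ncard_le_ncard ?_ (Set.toFinite _)) hle
  intro x hx
  have hsub : T.neighborSet x ⊆ {f x} := by
    intro y hy
    have hy' : H.Adj x y := hTH hy
    rcases hy'.2 with h | h | h
    · exact absurd h.1 hx
    · exact h.2
    · exact absurd (h.2 ▸ (hf y h.1).2) hx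
  obtain ⟨y, hy⟩ := hT.connected.preconnected.exists_adj_of_nontrivial x
  have hyf : y = f x := hsub hy
  have : T.neighborSet x = {f x} :=
    Set.Subset.antisymm hsub (by rintro z rfl; rw [← hyf]; exact hy)
  change (T.neighborSet x).ncard = 1
  rw [this, Set.ncard_singleton]

theorem tmc_upper {V : Type*} [Fintype V] (G : SimpleGraph V) (hG : G.Connected)
    (hn : 3 < Fintype.card V) (hdiam : 3 ≤ G.diam) (ce : Sym2 V → ℕ) (cv : V → ℕ)
    (h : IsTMCColoring G ce cv) :
    colorsUsed G ce cv + Fintype.card V ≤ G.edgeSet.ncard + 2 + maxLeaves G := by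
  classical
  have := hG.nonempty
  obtain ⟨u, v, huv⟩ := G.exists_dist_eq_diam
  have hd : 3 ≤ G.dist u v := huv ▸ hdiam
  have hne : u ≠ v := by
    rintro rfl
    simp at hd
  have hnadj : ¬ G.Adj u v := by
    intro h
    rw [← dist_eq_one_iff_adj] at h
    omega
  have hcn : ∀ x, ¬ (G.Adj u x ∧ G.Adj v x) := by
    rintro x ⟨h1, h2⟩
    have := G.dist_le (Walk.cons h1 (Walk.cons h2.symm Walk.nil))
    simp at this
    omega
  have hA := edge_colors_bound G ce u v hne hcn (fun a b hab => by
    obtain ⟨w, -, c, hc, -⟩ := h a b hab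
    exact ⟨w, c, hc⟩)
  let Q : Set V := {x | cv x ∈ ce '' G.edgeSet}
  have hQ : ∀ a b : V, a ≠ b → ∃ w : G.Walk a b, ∀ x ∈ w.support, x ≠ a → x ≠ b → x ∈ Q := by
    intro a b hab
    obtain ⟨w, -, c, hc, hv⟩ := h a b hab
    refine ⟨w, fun x hx hxa hxb => ?_⟩
    have h1 := hv x (walk_mem_interior w hx hxa hxb)
    cases w with
    | nil => exact absurd rfl hab
    | @cons _ y _ h q =>
      exact ⟨s(a, y), h, by rw [h1]; exact hc _ (by simp)⟩
  have hw : ∃ w₀, w₀ ∈ Q := by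
    obtain ⟨w, hw⟩ := hQ u v hne
    cases w with
    | nil => exact absurd rfl hne
    | @cons _ y _ h q =>
      exact ⟨y, hw y (by simp) h.ne' (fun e => hnadj (e ▸ h))⟩
  obtain ⟨w₀, hw₀⟩ := hw
  have hB := leaves_bound G Q hn w₀ hw₀ hQ
  have hsub : ce '' G.edgeSet ∪ Set.range cv ⊆ ce '' G.edgeSet ∪ cv '' Qᶜ := by
    rintro k (hk | ⟨x, rfl⟩)
    · exact Or.inl hk
    · by_cases hx : x ∈ Q
      · exact Or.inl hx
      · exact Or.inr ⟨x, hx, rfl⟩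
  have h1 : colorsUsed G ce cv ≤ (ce '' G.edgeSet).ncard + Qᶜ.ncard :=
    calc colorsUsed G ce cv ≤ (ce '' G.edgeSet ∪ cv '' Qᶜ).ncard :=
          Set.ncard_le_ncard hsub (Set.toFinite _)
      _ ≤ (ce '' G.edgeSet).ncard + (cv '' Qᶜ).ncard := Set.ncard_union_le _ _
      _ ≤ _ := Nat.add_le_add_left (Set.ncard_image_le (Set.toFinite _)) _
  omega

theorem interior_not_leaf {V : Type*} {T : SimpleGraph V} {a b : V} (w : T.Walk a b)
    (hw : w.IsPath) : ∀ x ∈ w.support.tail.dropLast, (T.neighborSet x).ncard ≠ 1 := by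
  induction w with
  | nil => simp
  | @cons a y b h q ih =>
    rw [Walk.cons_isPath_iff] at hw
    intro x hx
    cases q with
    | nil => simp at hx
    | @cons _ z _ h' r =>
      have ih' := ih hw.1 x
      simp only [Walk.support_cons, List.tail_cons] at hx ih'
      rw [List.dropLast_cons_of_ne_nil r.support_ne_nil, List.mem_cons] at hx
      rcases hx with rfl | hx
      · intro h1
        obtain ⟨t, ht⟩ := Set.ncard_eq_one.1 h1
        have e1 : a = t := by
          have : a ∈ T.neighborSet x := h.symm
          rwa [ht] at this
        have e2 : z = t := by
          have : z ∈ T.neighborSet x := h'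
          rwa [ht] at this
        apply hw.2
        rw [e1, ← e2]
        simp
      · exact ih' hx

theorem tmc_lower {V : Type*} [Fintype V] (G T : SimpleGraph V)
    (hn : 3 < Fintype.card V) (hTG : T ≤ G) (hT : T.IsTree) :
    ∃ ce cv, IsTMCColoring G ce cv ∧
      G.edgeSet.ncard + 2 + numLeaves T ≤ colorsUsed G ce cv + Fintype.card V := by
  classical
  have : Nontrivial V := Fintype.one_lt_card_iff_nontrivial.1 (by omega)
  obtain ⟨g, hg⟩ : ∃ g : Sym2 V ⊕ V → ℕ, Function.Injective g :=
    ⟨fun x => (Fintype.equivFin _ x : ℕ), fun x y h => by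
      simpa using Fin.ext h⟩
  let L : Set V := {v : V | (T.neighborSet v).ncard = 1}
  let ce : Sym2 V → ℕ := fun e => if e ∈ T.edgeSet then 0 else g (Sum.inl e) + 1
  let cv : V → ℕ := fun x => if x ∈ L then g (Sum.inr x) + 1 else 0
  refine ⟨ce, cv, ?_, ?_⟩
  · intro a b hab
    obtain ⟨w, hw⟩ := hT.connected.exists_isPath a b
    refine ⟨w.mapLe hTG, hw.mapLe hTG, 0, ?_, ?_⟩
    · intro e he
      rw [Walk.edges_mapLe_eq_edges] at he
      exact if_pos (w.edges_subset_edgeSet he)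
    · intro x hx
      rw [Walk.support_mapLe_eq_support] at hx
      exact if_neg (interior_not_leaf w hw x hx)
  · have hTe : T.edgeSet.ncard + 1 = Fintype.card V := by
      rw [← hT.card_edgeFinset, Set.ncard_eq_toFinset_card', edgeFinset]
    have hsubE : T.edgeSet ⊆ G.edgeSet := edgeSet_subset_edgeSet.2 hTG
    have hdiff := Set.ncard_sdiff_add_ncard_of_subset hsubE (Set.toFinite _)
    let A : Set (Option (Sym2 V ⊕ V)) :=
      insert none (some '' (Sum.inl '' (G.edgeSet \ T.edgeSet) ∪ Sum.inr '' L))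
    let F : Option (Sym2 V ⊕ V) → ℕ := fun o => o.elim 0 (fun s => g s + 1)
    have hF : Function.Injective F := by
      rintro (_ | x) (_ | y) h
      · rfl
      · simp [F] at h
      · simp [F] at h
      · simp only [F, Option.elim, Nat.add_right_cancel_iff] at h
        rw [hg h]
    have hA : A.ncard = (G.edgeSet \ T.edgeSet).ncard + L.ncard + 1 := by
      rw [Set.ncard_insert_of_notMem (by simp) (Set.toFinite _),
        Set.ncard_image_of_injective _ (Option.some_injective _),
        Set.ncard_union_eq ?_ (Set.toFinite _) (Set.toFinite _),
        Set.ncard_image_of_injective _ Sum.inl_injective,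
        Set.ncard_image_of_injective _ Sum.inr_injective]
      rw [Set.disjoint_left]
      rintro _ ⟨x, -, rfl⟩ ⟨y, -, h⟩
      cases h
    have hsub : F '' A ⊆ ce '' G.edgeSet ∪ Set.range cv := by
      rintro _ ⟨o, (rfl | ⟨_, ⟨e, he, rfl⟩ | ⟨x, hx, rfl⟩, rfl⟩), rfl⟩
      · left
        obtain ⟨x⟩ := hT.connected.nonempty
        obtain ⟨y, hy⟩ := hT.connected.preconnected.exists_adj_of_nontrivial x
        exact ⟨s(x, y), hTG hy, if_pos hy⟩
      · left
        exact ⟨e, he.1, if_neg he.2⟩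
      · right
        exact ⟨x, if_pos hx⟩
    have h1 := Set.ncard_le_ncard hsub (Set.toFinite _)
    rw [Set.ncard_image_of_injective _ hF, hA] at h1
    change _ + 2 + L.ncard ≤ (ce '' G.edgeSet ∪ Set.range cv).ncard + _
    omega

theorem stmt6 {V : Type*} [Fintype V] (G : SimpleGraph V) (hG : G.Connected)
    (hn : 3 < Fintype.card V) (hdiam : 3 ≤ G.diam) :
    (tmc G : ℤ) = (G.edgeSet.ncard : ℤ) - (Fintype.card V : ℤ) + 2 + (maxLeaves G : ℤ) := by
  have hne : {k | ∃ T : SimpleGraph V, T ≤ G ∧ T.IsTree ∧ numLeaves T = k}.Nonempty := by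
    obtain ⟨T, h1, h2⟩ := hG.exists_isTree_le
    exact ⟨_, T, h1, h2, rfl⟩
  obtain ⟨T, hTG, hT, hTl⟩ := Nat.sSup_mem hne (numLeaves_bdd G)
  change numLeaves T = maxLeaves G at hTl
  obtain ⟨ce, cv, hc, hlow⟩ := tmc_lower G T hn hTG hT
  have hbdd : BddAbove {k | ∃ ce cv, IsTMCColoring G ce cv ∧ colorsUsed G ce cv = k} := by
    refine ⟨G.edgeSet.ncard + 2 + maxLeaves G, ?_⟩
    rintro k ⟨ce, cv, h, rfl⟩
    have := tmc_upper G hG hn hdiam ce cv h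
    omega
  have h1 : colorsUsed G ce cv ≤ tmc G := le_csSup hbdd ⟨ce, cv, hc, rfl⟩
  have hne2 : {k | ∃ ce cv, IsTMCColoring G ce cv ∧ colorsUsed G ce cv = k}.Nonempty :=
    ⟨_, ce, cv, hc, rfl⟩
  obtain ⟨ce', cv', hc', heq⟩ := Nat.sSup_mem hne2 hbdd
  change colorsUsed G ce' cv' = tmc G at heq
  have h2 := tmc_upper G hG hn hdiam ce' cv' hc'
  omega
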